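/- Let n be a natural number, K : Fin n → ℝ with K j > 0 for all j, and define F : (Fin n → ℝ) → ℝ by F(x) = ∑_{j} (x j - √((x j)² - 4·K j))/2. Let C be a convex subset of {x : Fin n → ℝ | ∀ j, x j > 2√(K j)}. If x and y both minimize F over C (i.e., both are points of C attaining the minimum of F on C), then x = y. In particular, the client's delay-minimization problem has at most one solution. -/

import Mathlib

theorem strictConcaveOn_sqrt_sq_sub {k : ℝ} (hk : 0 < k) :
    StrictConcaveOn ℝ (Set.Ioi (2 * Real.sqrt k)) fun x => Real.sqrt (x ^ 2 - 4 * k) := by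
  refine ⟨convex_Ioi _, ?_⟩
  intro a ha b hb hab s t hs ht hst
  rw [Set.mem_Ioi] at ha hb
  have hr : 0 < Real.sqrt k := Real.sqrt_pos.2 hk
  have hrk : Real.sqrt k ^ 2 = k := Real.sq_sqrt hk.le
  have hu2 : Real.sqrt (a ^ 2 - 4 * k) ^ 2 = a ^ 2 - 4 * k := Real.sq_sqrt (by nlinarith)
  have hv2 : Real.sqrt (b ^ 2 - 4 * k) ^ 2 = b ^ 2 - 4 * k := Real.sq_sqrt (by nlinarith)
  have hkab : 4 * k < a * b := by nlinarith
  have hd : 0 < (a - b) ^ 2 := sq_pos_of_ne_zero (sub_ne_zero.2 hab)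
  simp only [smul_eq_mul]
  set u := Real.sqrt (a ^ 2 - 4 * k)
  set v := Real.sqrt (b ^ 2 - 4 * k)
  have huv : u * v < a * b - 4 * k := by
    refine lt_of_pow_lt_pow_left₀ 2 (by linarith) ?_
    rw [mul_pow, hu2, hv2]
    nlinarith [mul_pos hk hd]
  apply Real.lt_sqrt_of_sq_lt
  have h1 : (s + t) ^ 2 = 1 := by rw [hst, one_pow]
  linear_combination 2 * (s * t) * huv + s ^ 2 * hu2 + t ^ 2 * hv2 - 4 * k * h1

/-- A separable sum of strictly convex functions is strictly convex on the product domain. -/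
theorem strictConvexOn_sum_pi {ι : Type*} [Fintype ι] {s : ι → Set ℝ} {f : ι → ℝ → ℝ}
    (hf : ∀ i, StrictConvexOn ℝ (s i) (f i)) :
    StrictConvexOn ℝ (Set.univ.pi s) fun x : ι → ℝ => ∑ i, f i (x i) := by
  refine ⟨convex_pi fun i _ => (hf i).1, ?_⟩
  intro x hx y hy hxy a b ha hb hab
  obtain ⟨i, hi⟩ := Function.ne_iff.1 hxy
  simp only [smul_eq_mul, Finset.mul_sum, ← Finset.sum_add_distrib]
  exact Finset.sum_lt_sum
    (fun j _ => (hf j).convexOn.2 (hx j trivial) (hy j trivial) ha.le hb.le hab)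
    ⟨i, Finset.mem_univ i, (hf i).2 (hx i trivial) (hy i trivial) hi ha hb hab⟩

theorem strictConvexOn_sub_sqrt_sq_sub_div_two {k : ℝ} (hk : 0 < k) :
    StrictConvexOn ℝ (Set.Ioi (2 * Real.sqrt k))
      fun x => (x - Real.sqrt (x ^ 2 - 4 * k)) / 2 := by
  refine ⟨convex_Ioi _, ?_⟩
  intro a ha b hb hab s t hs ht hst
  have h := (strictConcaveOn_sqrt_sq_sub hk).2 ha hb hab hs ht hst
  simp only [smul_eq_mul] at h ⊢
  linarith


/-- The client's delay-minimization problem has at most one solution: if `x` and `y`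
both minimize `F(x) = ∑_j (x j - √((x j)² - 4 K j))/2` over a convex subset `C` of
the domain `{x | ∀ j, x j > 2√(K j)}`, then `x = y`. -/
theorem delay_min_unique (n : ℕ) (K : Fin n → ℝ) (hK : ∀ j, 0 < K j)
    (C : Set (Fin n → ℝ)) (hCconv : Convex ℝ C)
    (hCsub : C ⊆ {x : Fin n → ℝ | ∀ j, x j > 2 * Real.sqrt (K j)})
    (F : (Fin n → ℝ) → ℝ)
    (hF : F = fun x => ∑ j, (x j - Real.sqrt ((x j) ^ 2 - 4 * K j)) / 2)
    (x y : Fin n → ℝ) (hx : x ∈ C) (hy : y ∈ C)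
    (hxmin : IsMinOn F C x) (hymin : IsMinOn F C y) :
    x = y := by
  have hconv : StrictConvexOn ℝ C F := by
    rw [hF]
    exact (strictConvexOn_sum_pi fun j => strictConvexOn_sub_sqrt_sq_sub_div_two (hK j)).subset
      (fun z hz j _ => hCsub hz j) hCconv
  exact hconv.eq_of_isMinOn hxmin hymin hx hy
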